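/- Let M = p²q²r² with p < q < r primes, A, B ⊆ ℤ_M with A ⊕ B = ℤ_M, |A| = |B| = pqr, 1 ∉ Div(B), (Φ_p Φ_q Φ_r) | A(x), and p, q ∈ Div(B), p², q² ∉ Div(B). If additionally Div(B) contains none of p²qr, p²q²r, p²qr² — equivalently at least one of these lies in Div(A) — this leads to a contradiction; hence {p²qr, p²q²r, p²qr²} ∩ Div(A) = ∅. -/

import Mathlib

open Finset Polynomial

/-- `A ⊕ B = ℤ_M`: unique representation of every element as `a + b`. -/
def Tiles {M : ℕ} (A B : Finset (ZMod M)) : Prop :=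
  ∀ g : ZMod M, ∃! ab : ZMod M × ZMod M, ab.1 ∈ A ∧ ab.2 ∈ B ∧ ab.1 + ab.2 = g

/-- The division set `Div(E) = {gcd(a - a', M) : a, a' ∈ E}`. -/
def DivSet {M : ℕ} (E : Finset (ZMod M)) : Set ℕ :=
  {d | ∃ a ∈ E, ∃ b ∈ E, Nat.gcd ((a - b).val) M = d}

/-- `E` is not contained in any proper subgroup `dℤ_M` (`d ∣ M`, `d > 1`). -/
def NotInProperSubgroup {M : ℕ} (E : Finset (ZMod M)) : Prop :=
  ∀ d : ℕ, d ∣ M → 1 < d → ∃ x ∈ E, ¬ d ∣ x.val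

/-- The mask polynomial `E(x) = Σ_{a ∈ E} x^a`, representatives in `{0, …, M-1}`. -/
noncomputable def maskPoly {M : ℕ} (E : Finset (ZMod M)) : Polynomial ℤ :=
  ∑ a ∈ E, X ^ a.val

theorem aux_shift (n l e : ℕ) [NeZero n] (hn : n = l ^ (e+1)) (hl : l.Prime) (g : ZMod n → ℂ)
    (H : ∀ ω : ℂ, IsPrimitiveRoot ω n → ∑ t, g t * ω ^ t.val = 0) (t t' : ZMod n)
    (h : t.val ≡ t'.val [MOD l ^ e]) : g t = g t' := by
  obtain ⟨s, hs⟩ : ∃ s : ZMod n, t' = t + s * ((l^e : ℕ) : ZMod n) := by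
    rw [Nat.modEq_iff_dvd] at h
    obtain ⟨s, hs⟩ := h
    refine ⟨(s : ZMod n), ?_⟩
    have := congrArg (fun z : ℤ => (z : ZMod n)) hs
    simp only [Int.cast_sub, Int.cast_natCast, Int.cast_mul, ZMod.natCast_zmod_val] at this
    rw [mul_comm, ← this]; ring
  set v : ZMod n := s * ((l^e : ℕ) : ZMod n) with hv
  set h' : ZMod n → ℂ := fun x => g x - g (x + v) with hh
  suffices h' = 0 by
    have := congrFun this t
    simp only [hh, Pi.zero_apply] at this
    rw [hs]; exact sub_eq_zero.mp this
  apply (ZMod.dft (N := n) (E := ℂ)).injective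
  rw [map_zero]
  ext k
  rw [ZMod.dft_apply]
  set ω : ℂ := ZMod.stdAddChar (-k) with hω
  have hpow : ∀ j : ZMod n, ZMod.stdAddChar (-(j * k)) = ω ^ j.val := by
    intro j
    rw [hω, ← AddChar.map_nsmul_eq_pow]; congr 1; simp
  have h1 : ω ^ n = 1 := by
    rw [hω, ← AddChar.map_nsmul_eq_pow]; simp
  have hsum : ∑ j, ZMod.stdAddChar (-(j * k)) • h' j
      = ∑ j, g j * ω ^ j.val - (ZMod.stdAddChar (v * k)) * ∑ j, g j * ω ^ j.val := by
    simp only [hh, smul_sub, Finset.sum_sub_distrib, ← hpow]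
    congr 1
    · simp [mul_comm]
    · rw [Finset.mul_sum, ← Equiv.sum_comp (Equiv.addRight v) (fun j => ZMod.stdAddChar (v * k) * (g j * ZMod.stdAddChar (-(j * k))))]
      apply Finset.sum_congr rfl
      intro j _
      simp only [Equiv.coe_addRight, smul_eq_mul]
      rw [mul_left_comm, ← AddChar.map_add_eq_mul, mul_comm]
      congr 2; ring
  rw [hsum]
  have ho : orderOf ω ∣ l ^ (e+1) := hn ▸ orderOf_dvd_of_pow_eq_one h1
  obtain ⟨i, hi, hio⟩ := (Nat.dvd_prime_pow hl).1 ho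
  rcases Nat.lt_or_ge i (e+1) with hlt | hge
  · have h2 : ω ^ (l^e) = 1 := by
      rw [← orderOf_dvd_iff_pow_eq_one, hio]; exact pow_dvd_pow _ (by omega)
    have : ZMod.stdAddChar (v * k) = (1:ℂ) := by
      have : v * k = -((s.val * l^e) • (-k)) := by
        simp [nsmul_eq_mul, hv]
      rw [this, AddChar.map_neg_eq_inv, AddChar.map_nsmul_eq_pow, ← hω, mul_comm, pow_mul, h2]; simp
    rw [this]; simp
  · have : i = e+1 := by omega
    subst this
    rw [H ω (by rw [hn, ← hio]; exact IsPrimitiveRoot.orderOf ω)]; simp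

/-- difference of two indicators of residue classes -/
noncomputable def dl (n : ℕ) (t t' : ZMod n) (x : ℕ) : ℂ :=
  (if (x : ZMod n) = t then 1 else 0) - (if (x : ZMod n) = t' then 1 else 0)

theorem aux_fib {α : Type*} (E : Finset α) (ρ : α → ℕ) (w : α → ℂ)
    (n l e : ℕ) [NeZero n] (hn : n = l ^ (e+1)) (hl : l.Prime)
    (H : ∀ ω : ℂ, IsPrimitiveRoot ω n → ∑ a ∈ E, w a * ω ^ ρ a = 0) (t t' : ZMod n)
    (h : t.val ≡ t'.val [MOD l ^ e]) : ∑ a ∈ E, w a * dl n t t' (ρ a) = 0 := by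
  have := aux_shift n l e hn hl (fun t => ∑ a ∈ E with (ρ a : ZMod n) = t, w a) (by
    intro ω hω
    rw [← H ω hω, ← Finset.sum_fiberwise E (fun a => (ρ a : ZMod n))]
    apply Finset.sum_congr rfl
    intro j _
    rw [Finset.sum_mul]
    apply Finset.sum_congr rfl
    intro a ha
    rw [Finset.mem_filter] at ha
    congr 1
    rw [← ha.2, ZMod.val_natCast]
    conv_rhs => rw [← Nat.div_add_mod (ρ a) n, pow_add, pow_mul, hω.pow_eq_one]
    simp) t t' h
  simp only [dl, mul_sub, Finset.sum_sub_distrib, mul_ite, mul_one, mul_zero, ← Finset.sum_filter]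
  exact sub_eq_zero.mpr this

theorem prim_mul {a b : ℂ} {m n : ℕ} (ha : IsPrimitiveRoot a m) (hb : IsPrimitiveRoot b n)
    (h : m.Coprime n) : IsPrimitiveRoot (a * b) (m * n) := by
  rw [IsPrimitiveRoot.iff_orderOf] at *
  subst ha hb
  exact (Commute.all a b).orderOf_mul_eq_mul_orderOf_of_coprime h

/-- vanishing at all primitive `s`-th roots of unity -/
def Van {M : ℕ} (E : Finset (ZMod M)) (s : ℕ) : Prop :=
  ∀ ω : ℂ, IsPrimitiveRoot ω s → ∑ a ∈ E, ω ^ a.val = 0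

theorem van1 {M : ℕ} (E : Finset (ZMod M)) (n l e : ℕ) [NeZero n] (hn : n = l ^ (e+1)) (hl : l.Prime)
    (H : Van E n) (t t' : ZMod n) (h : t.val ≡ t'.val [MOD l ^ e]) :
    ∑ a ∈ E, dl n t t' a.val = 0 := by
  have := aux_fib E (fun a => a.val) (fun _ => 1) n l e hn hl (by intro ω hω; simpa using H ω hω) t t' h
  simpa using this

theorem van2 {M : ℕ} (E : Finset (ZMod M)) (n l e n2 l2 e2 : ℕ) [NeZero n] [NeZero n2]
    (hn : n = l ^ (e+1)) (hl : l.Prime) (hn2 : n2 = l2 ^ (e2+1)) (hl2 : l2.Prime)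
    (hc : n.Coprime n2)
    (H : Van E (n * n2)) (t t' : ZMod n) (h : t.val ≡ t'.val [MOD l ^ e])
    (y y' : ZMod n2) (h2 : y.val ≡ y'.val [MOD l2 ^ e2]) :
    ∑ a ∈ E, dl n t t' a.val * dl n2 y y' a.val = 0 := by
  refine aux_fib E (fun a => a.val) (fun a => dl n t t' a.val) n2 l2 e2 hn2 hl2 ?_ y y' h2
  intro ω2 hω2
  have := aux_fib E (fun a => a.val) (fun a => ω2 ^ a.val) n l e hn hl ?_ t t' h
  · simpa only [mul_comm] using this
  intro ω hω
  have := H _ (prim_mul hω hω2 hc)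
  simpa only [mul_pow, mul_comm] using this

theorem van3 {M : ℕ} (E : Finset (ZMod M)) (n l e n2 l2 e2 n3 l3 e3 : ℕ)
    [NeZero n] [NeZero n2] [NeZero n3]
    (hn : n = l ^ (e+1)) (hl : l.Prime) (hn2 : n2 = l2 ^ (e2+1)) (hl2 : l2.Prime)
    (hn3 : n3 = l3 ^ (e3+1)) (hl3 : l3.Prime)
    (hc : n.Coprime n2) (hc' : (n * n2).Coprime n3)
    (H : Van E (n * n2 * n3)) (t t' : ZMod n) (h : t.val ≡ t'.val [MOD l ^ e])
    (y y' : ZMod n2) (h2 : y.val ≡ y'.val [MOD l2 ^ e2])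
    (z z' : ZMod n3) (h3 : z.val ≡ z'.val [MOD l3 ^ e3]) :
    ∑ a ∈ E, dl n t t' a.val * dl n2 y y' a.val * dl n3 z z' a.val = 0 := by
  refine aux_fib E (fun a => a.val) (fun a => dl n t t' a.val * dl n2 y y' a.val) n3 l3 e3 hn3 hl3 ?_ z z' h3
  intro ω3 hω3
  have := aux_fib E (fun a => a.val) (fun a => dl n t t' a.val * ω3 ^ a.val) n2 l2 e2 hn2 hl2 ?_ y y' h2
  · rw [← this]; apply Finset.sum_congr rfl; intro a _; ring
  intro ω2 hω2
  have := aux_fib E (fun a => a.val) (fun a => ω2 ^ a.val * ω3 ^ a.val) n l e hn hl ?_ t t' h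
  · rw [← this]; apply Finset.sum_congr rfl; intro a _; ring
  intro ω hω
  have := H _ (prim_mul (prim_mul hω hω2 hc) hω3 hc')
  rw [← this]; apply Finset.sum_congr rfl; intro a _; ring

theorem aeval_mask {M : ℕ} (E : Finset (ZMod M)) (ω : ℂ) :
    aeval ω (maskPoly E) = ∑ a ∈ E, ω ^ a.val := by
  simp [maskPoly]

theorem van_of_dvd {M : ℕ} (E : Finset (ZMod M)) (s : ℕ) (hs : 0 < s)
    (h : cyclotomic s ℤ ∣ maskPoly E) : Van E s := by
  intro ω hω
  rw [← aeval_mask]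
  obtain ⟨Q, hQ⟩ := h
  rw [hQ, map_mul, cyclotomic_eq_minpoly hω hs, minpoly.aeval, zero_mul]

theorem dvd_of_root {M : ℕ} (E : Finset (ZMod M)) (s : ℕ) (hs : 0 < s) (ω : ℂ)
    (hω : IsPrimitiveRoot ω s)
    (h : ∑ a ∈ E, ω ^ a.val = 0) : cyclotomic s ℤ ∣ maskPoly E := by
  rw [← aeval_mask] at h
  rw [cyclotomic_eq_minpoly hω hs]
  exact minpoly.isIntegrallyClosed_dvd (hω.isIntegral hs) h

theorem pow_add_val {M : ℕ} [NeZero M] (ω : ℂ) (h : ω ^ M = 1) (a b : ZMod M) :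
    ω ^ (a + b).val = ω ^ a.val * ω ^ b.val := by
  rw [ZMod.val_add, ← pow_add]
  conv_rhs => rw [← Nat.div_add_mod (a.val + b.val) M, pow_add, pow_mul, h]
  simp

theorem tiles_sum {M : ℕ} [NeZero M] {A B : Finset (ZMod M)} (hT : Tiles A B) (f : ZMod M → ℂ) :
    ∑ ab ∈ A ×ˢ B, f (ab.1 + ab.2) = ∑ g, f g := by
  refine Finset.sum_bij (fun ab _ => ab.1 + ab.2) (fun _ _ => Finset.mem_univ _) ?_ ?_ ?_
  · intro x hx y hy hxy
    rw [Finset.mem_product] at hx hy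
    exact (hT (x.1 + x.2)).unique ⟨hx.1, hx.2, rfl⟩ ⟨hy.1, hy.2, hxy.symm⟩
  · intro g _
    obtain ⟨ab, ⟨h1, h2, h3⟩, _⟩ := hT g
    exact ⟨ab, Finset.mem_product.2 ⟨h1, h2⟩, h3⟩
  · intros; rfl

theorem dich {M : ℕ} [NeZero M] {A B : Finset (ZMod M)} (hT : Tiles A B) (s : ℕ) (hs : s ∣ M)
    (h1 : 1 < s) : cyclotomic s ℤ ∣ maskPoly A ∨ cyclotomic s ℤ ∣ maskPoly B := by
  have hω := Complex.isPrimitiveRoot_exp s (by omega)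
  set ω := Complex.exp (2 * Real.pi * Complex.I / s)
  have hM : ω ^ M = 1 := (hω.pow_eq_one_iff_dvd M).2 hs
  have h := tiles_sum hT (fun g => ω ^ g.val)
  have h2 : ∑ g : ZMod M, ω ^ g.val = 0 := by
    have h3 : ∑ g : ZMod M, ω ^ g.val = ∑ i ∈ range M, ω ^ i := by
      refine Finset.sum_bij (fun g _ => g.val) (fun g _ => Finset.mem_range.2 (ZMod.val_lt g)) 
        (fun a _ b _ h => ZMod.val_injective M h) ?_ (fun _ _ => rfl)
      intro i hi
      exact ⟨(i : ZMod M), Finset.mem_univ _, ZMod.val_cast_of_lt (Finset.mem_range.1 hi)⟩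
    have h4 := geom_sum_mul ω M
    rw [hM, sub_self, ← h3] at h4
    exact (mul_eq_zero.1 h4).resolve_right (sub_ne_zero.2 (hω.ne_one h1))
  rw [h2] at h
  simp only [pow_add_val ω hM] at h
  rw [Finset.sum_product] at h
  simp only [] at h
  rw [← Finset.sum_mul_sum] at h
  rcases mul_eq_zero.1 h with h | h
  · exact Or.inl (dvd_of_root A s (by omega) ω hω h)
  · exact Or.inr (dvd_of_root B s (by omega) ω hω h)

theorem sands {M : ℕ} [NeZero M] {A B : Finset (ZMod M)} (hT : Tiles A B) (d : ℕ)
    (hA : d ∈ DivSet A) (hB : d ∈ DivSet B) : d = M := by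
  obtain ⟨a, ha, a', ha', hd⟩ := hA
  obtain ⟨b, hb, b', hb', hd'⟩ := hB
  have assoc : ∀ x : ZMod M, ∃ u : ZMod M, IsUnit u ∧ x = u * (Nat.gcd x.val M : ℕ) := by
    intro x
    obtain ⟨d, hd, u, hu, hx⟩ := ZMod.eq_unit_mul_divisor x
    refine ⟨u, hu, ?_⟩
    suffices h : Nat.gcd x.val M = d by rw [h]; exact hx
    obtain ⟨v, rfl⟩ := hu
    have hval : x.val = ((v : ZMod M).val * d) % M := by
      rw [← ZMod.val_natCast]; rw [hx]; simp
    rw [hval, ← Nat.gcd_rec, Nat.gcd_comm,]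
    have hc := ZMod.val_coe_unit_coprime v
    rw [Nat.Coprime.gcd_mul_left_cancel d hc]
    exact Nat.gcd_eq_left hd
  obtain ⟨u1, hu1, e1⟩ := assoc (a - a')
  obtain ⟨u2, hu2, e2⟩ := assoc (b - b')
  rw [hd] at e1
  rw [hd'] at e2
  obtain ⟨u1, rfl⟩ := hu1
  obtain ⟨u2, rfl⟩ := hu2
  set u : (ZMod M)ˣ := u1 * u2⁻¹ with hu
  have e3 : a - a' = u * (b - b') := by
    rw [e1, e2, hu]; simp [mul_assoc]
  -- counting function
  have key : ∀ g, (∑ ab ∈ A ×ˢ B, if ab.1 + u * ab.2 = g then (1:ℂ) else 0) = 1 := by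
    suffices h : (fun g => (∑ ab ∈ A ×ˢ B, if ab.1 + u * ab.2 = g then (1:ℂ) else 0))
       = (fun g => (∑ ab ∈ A ×ˢ B, if ab.1 + ab.2 = g then (1:ℂ) else 0)) by
      intro g
      have := congrFun h g
      rw [this, tiles_sum hT (fun x => if x = g then (1:ℂ) else 0)]
      simp
    apply (ZMod.dft (N := M) (E := ℂ)).injective
    ext k
    have gen : ∀ v : ZMod M, ∑ j, ZMod.stdAddChar (-(j * k)) • (∑ ab ∈ A ×ˢ B, if ab.1 + v * ab.2 = j then (1:ℂ) else 0)
        = (∑ a ∈ A, (ZMod.stdAddChar (-k)) ^ a.val) * (∑ b ∈ B, (ZMod.stdAddChar (-(v * k))) ^ b.val) := by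
      intro v
      simp only [Finset.smul_sum]
      rw [Finset.sum_comm]
      simp only [smul_eq_mul, mul_ite, mul_one, mul_zero, Finset.sum_ite_eq, Finset.mem_univ, if_true]
      rw [Finset.sum_product, Finset.sum_mul_sum]
      apply Finset.sum_congr rfl
      intro a _
      apply Finset.sum_congr rfl
      intro b _
      rw [← AddChar.map_nsmul_eq_pow, ← AddChar.map_nsmul_eq_pow, ← AddChar.map_add_eq_mul]
      congr 1
      simp
      ring
    have gen1 := gen 1
    simp only [one_mul] at gen1
    rw [ZMod.dft_apply, ZMod.dft_apply, gen, gen1]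
    by_cases hk : k = 0
    · subst hk; simp
    have hprim : IsPrimitiveRoot (ZMod.stdAddChar (-k) : ℂ) (orderOf (ZMod.stdAddChar (-k) : ℂ)) :=
      IsPrimitiveRoot.orderOf _
    set s := orderOf (ZMod.stdAddChar (-k) : ℂ) with hs
    have hsM : s ∣ M := orderOf_dvd_of_pow_eq_one (by
      rw [← AddChar.map_nsmul_eq_pow]; simp)
    have hpos : 0 < s := Nat.pos_of_dvd_of_pos hsM (NeZero.pos M)
    have hs1 : 1 < s := by
      by_contra hcon
      have : s = 1 := by omega
      rw [hs, orderOf_eq_one_iff] at this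
      rw [← AddChar.map_zero_eq_one (ZMod.stdAddChar (N := M))] at this
      have := ZMod.injective_stdAddChar this
      exact hk (neg_eq_zero.1 this)
    have hprim2 : IsPrimitiveRoot (ZMod.stdAddChar (-((u : ZMod M) * k)) : ℂ) s := by
      have : -((u : ZMod M) * k) = (u : ZMod M).val • (-k) := by simp
      rw [this, AddChar.map_nsmul_eq_pow]
      apply hprim.pow_of_coprime
      exact (ZMod.val_coe_unit_coprime u).coprime_dvd_right hsM
    rcases dich hT s hsM hs1 with h | h
    · rw [van_of_dvd A s hpos h _ hprim]; simp
    · rw [van_of_dvd B s hpos h _ hprim, van_of_dvd B s hpos h _ hprim2]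
  have hkey := key (a + u * b')
  rw [Finset.sum_boole] at hkey
  have hc : (filter (fun ab : ZMod M × ZMod M => ab.1 + u * ab.2 = a + u * b') (A ×ˢ B)).card = 1 := by
    exact_mod_cast hkey
  rw [Finset.card_eq_one] at hc
  obtain ⟨x, hx⟩ := hc
  have m1 : (a, b') ∈ ({x} : Finset _) := by
    rw [← hx]; simp [ha, hb']
  have m2 : (a', b) ∈ ({x} : Finset _) := by
    rw [← hx]; simp only [mem_filter, mem_product]; refine ⟨⟨ha', hb⟩, ?_⟩
    linear_combination -e3
  rw [Finset.mem_singleton] at m1 m2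
  have : a = a' := congrArg Prod.fst (m1.trans m2.symm)
  rw [← hd, this]; simp

theorem core {ι κ : Type*} [Fintype ι] [Fintype κ] [DecidableEq ι] [DecidableEq κ] (f f' : ι → κ → ℤ)
    (y0 : ι) (z0 : κ) (y1 : ι) (z1 : κ) (hy : y1 ≠ y0) (hz : z1 ≠ z0)
    (hf : ∀ y z, y ≠ y0 → f y z = 0) (hf' : ∀ y z, z ≠ z0 → f' y z = 0)
    (hs : ∑ y, ∑ z, f y z = ∑ y, ∑ z, f' y z)
    (hm : ∀ y z y' z', (f y z - f' y z) - (f y' z - f' y' z) - (f y z' - f' y z') + (f y' z' - f' y' z') = 0) :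
    (Fintype.card κ : ℤ) * f y0 z1 = Fintype.card ι * f' y1 z0 ∧
    (∀ z, z ≠ z0 → f y0 z = f y0 z1) ∧ (∀ y, y ≠ y0 → f' y z0 = f' y1 z0) ∧
    ∑ y, ∑ z, f y z = f y0 z0 + (Fintype.card κ - 1) * f y0 z1 := by
  have e : ∀ y z, y ≠ y0 → z ≠ z0 → f y0 z - f' y z0 = f y0 z0 - f' y0 z0 := by
    intro y z h1 h2
    have := hm y0 z0 y z
    rw [hf y z h1, hf y z0 h1, hf' y z h2, hf' y0 z h2] at this
    linarith
  have c1 : ∀ z, z ≠ z0 → f y0 z = f y0 z1 := fun z h => by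
    have := e y1 z hy h; have := e y1 z1 hy hz; linarith
  have c2 : ∀ y, y ≠ y0 → f' y z0 = f' y1 z0 := fun y h => by
    have := e y z1 h hz; have := e y1 z1 hy hz; linarith
  have t1 : ∑ y, ∑ z, f y z = f y0 z0 + (Fintype.card κ - 1) * f y0 z1 := by
    rw [Finset.sum_eq_single y0 (fun y _ h => Finset.sum_eq_zero (fun z _ => hf y z h)) (by simp)]
    rw [← Finset.add_sum_erase _ _ (Finset.mem_univ z0)]
    rw [Finset.sum_congr rfl (fun z hz => c1 z (Finset.ne_of_mem_erase hz))]
    rw [Finset.sum_const, Finset.card_erase_of_mem (Finset.mem_univ _), Finset.card_univ, nsmul_eq_mul,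
      Nat.cast_sub (Fintype.card_pos_iff.2 ⟨z0⟩)]
    simp
  have t2 : ∑ y, ∑ z, f' y z = f' y0 z0 + (Fintype.card ι - 1) * f' y1 z0 := by
    rw [Finset.sum_comm]
    rw [Finset.sum_eq_single z0 (fun z _ h => Finset.sum_eq_zero (fun y _ => hf' y z h)) (by simp)]
    rw [← Finset.add_sum_erase _ _ (Finset.mem_univ y0)]
    rw [Finset.sum_congr rfl (fun z hz => c2 z (Finset.ne_of_mem_erase hz))]
    rw [Finset.sum_const, Finset.card_erase_of_mem (Finset.mem_univ _), Finset.card_univ, nsmul_eq_mul,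
      Nat.cast_sub (Fintype.card_pos_iff.2 ⟨y0⟩)]
    simp
  refine ⟨?_, c1, c2, t1⟩
  have := e y1 z1 hy hz
  rw [t1, t2] at hs
  linarith

theorem const_of {ι κ : Type*} [Fintype ι] [Fintype κ] [Nonempty ι] [Nonempty κ] (D : ι → κ → ℤ)
    (hm : ∀ y z y' z', D y z - D y' z - D y z' + D y' z' = 0)
    (hr : ∀ y y', ∑ z, D y z = ∑ z, D y' z) (hc : ∀ z z', ∑ y, D y z = ∑ y, D y z') :
    ∀ y z y' z', D y z = D y' z' := by
  have h1 : ∀ y y' z, D y z = D y' z := by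
    intro y y' z
    have : ∑ z' : κ, (D y z - D y' z) = 0 := by
      rw [← sub_eq_zero.2 (hr y y'), ← Finset.sum_sub_distrib]
      exact Finset.sum_congr rfl (fun z' _ => by linarith [hm y z y' z'])
    rw [Finset.sum_const, smul_eq_zero] at this
    rcases this with h | h
    · simp at h
    · linarith
  intro y z y' z'
  have : ∑ y'' : ι, (D y z - D y z') = 0 := by
    rw [← sub_eq_zero.2 (hc z z'), ← Finset.sum_sub_distrib]
    exact Finset.sum_congr rfl (fun y'' _ => by linarith [hm y z y'' z'])
  rw [Finset.sum_const, smul_eq_zero] at this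
  rcases this with h | h
  · simp at h
  · rw [sub_eq_zero.1 h]; exact h1 _ _ _

section cnt
variable {α τ ι κ : Type*} [DecidableEq τ] [DecidableEq ι] [DecidableEq κ]

/-- number of elements with given residues -/
def cnt (E : Finset α) (T : α → τ) (Y : α → ι) (Z : α → κ) (t : τ) (y : ι) (z : κ) : ℤ :=
  ∑ a ∈ E, (if T a = t then 1 else 0) * (if Y a = y then 1 else 0) * (if Z a = z then 1 else 0)

/-- number of elements with given residue -/
def S1 (E : Finset α) (T : α → τ) (t : τ) : ℤ := ∑ a ∈ E, (if T a = t then 1 else 0)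

theorem cnt_nonneg (E : Finset α) (T : α → τ) (Y : α → ι) (Z : α → κ) (t : τ) (y : ι) (z : κ) :
    0 ≤ cnt E T Y Z t y z := by
  apply Finset.sum_nonneg; intro a _; split_ifs <;> simp

theorem cnt_pos (E : Finset α) (T : α → τ) (Y : α → ι) (Z : α → κ) (a : α) (ha : a ∈ E) :
    0 < cnt E T Y Z (T a) (Y a) (Z a) := by
  apply Finset.sum_pos'
  · intro a _; split_ifs <;> simp
  · exact ⟨a, ha, by simp⟩

theorem cnt_ne (E : Finset α) (T : α → τ) (Y : α → ι) (Z : α → κ) (t : τ) (y : ι) (z : κ)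
    (h : cnt E T Y Z t y z ≠ 0) : ∃ a ∈ E, T a = t ∧ Y a = y ∧ Z a = z := by
  by_contra hcon
  push Not at hcon
  apply h
  apply Finset.sum_eq_zero
  intro a ha
  by_cases h1 : T a = t
  · by_cases h2 : Y a = y
    · simp [hcon a ha h1 h2]
    · simp [h2]
  · simp [h1]

theorem cnt_sum [Fintype ι] [Fintype κ] (E : Finset α) (T : α → τ) (Y : α → ι) (Z : α → κ) (t : τ) :
    ∑ y, ∑ z, cnt E T Y Z t y z = S1 E T t := by
  simp only [cnt, S1]
  simp only [Finset.sum_comm (t := E), ← Finset.mul_sum]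
  simp

theorem cnt_sumZ [Fintype τ] [Fintype ι] (E : Finset α) (T : α → τ) (Y : α → ι) (Z : α → κ) (z : κ) :
    ∑ t, ∑ y, cnt E T Y Z t y z = S1 E Z z := by
  simp only [cnt, S1]
  simp only [Finset.sum_comm (t := E), ← Finset.mul_sum, ← Finset.sum_mul]
  simp

theorem cnt_sum_z [Fintype κ] (E : Finset α) (T : α → τ) (Y : α → ι) (Z : α → κ) (t : τ) (y : ι) :
    ∑ z, cnt E T Y Z t y z = ∑ a ∈ E, (if T a = t then 1 else 0) * (if Y a = y then 1 else 0) := by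
  simp only [cnt]
  simp only [Finset.sum_comm (t := E), ← Finset.mul_sum, ← Finset.sum_mul]
  simp

theorem cnt_sum_y [Fintype ι] (E : Finset α) (T : α → τ) (Y : α → ι) (Z : α → κ) (t : τ) (z : κ) :
    ∑ y, cnt E T Y Z t y z = ∑ a ∈ E, (if T a = t then 1 else 0) * (if Z a = z then 1 else 0) := by
  simp only [cnt]
  simp only [Finset.sum_comm (t := E), ← Finset.mul_sum, ← Finset.sum_mul]
  simp

theorem S1_nonneg (E : Finset α) (T : α → τ) (t : τ) : 0 ≤ S1 E T t := by
  apply Finset.sum_nonneg; intro a _; split_ifs <;> simp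

theorem S1_total [Fintype τ] (E : Finset α) (T : α → τ) : ∑ t, S1 E T t = E.card := by
  simp only [S1]
  rw [Finset.sum_comm]
  simp

theorem S1_fiber [Fintype τ] (E : Finset α) (T : α → τ) (π : τ → ι) (x : ι) :
    ∑ t with π t = x, S1 E T t = S1 E (fun a => π (T a)) x := by
  simp only [S1]
  rw [Finset.sum_comm]
  apply Finset.sum_congr rfl
  intro a _
  rw [Finset.sum_ite_eq]
  simp
end cnt

theorem fiber_card (l : ℕ) [NeZero l] (x : ZMod l) :
    (univ.filter (fun t : ZMod (l^2) => (t.val : ZMod l) = x)).card = l := by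
  have hd : l ∣ l ^ 2 := Dvd.intro_left (l ^ 1) (by ring)
  let f : ZMod (l^2) →+ ZMod l := (ZMod.castHom hd (ZMod l)).toAddMonoidHom
  have hf : ∀ t : ZMod (l^2), (t.val : ZMod l) = f t := by
    intro t; simp [f]
  have hsurj : Function.Surjective f := ZMod.castHom_surjective hd
  have hcard : ∀ x', (univ.filter (fun t : ZMod (l^2) => f t = x')).card
      = (univ.filter (fun t : ZMod (l^2) => f t = x)).card := by
    intro x'
    exact AddMonoidHom.card_fiber_eq_of_mem_range f (hsurj x') (hsurj x)
  have h2 := Finset.card_eq_sum_card_fiberwise (s := (univ : Finset (ZMod (l^2)))) (t := (univ : Finset (ZMod l))) (f := f) (by intro _ _; simp)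
  simp only [hcard] at h2
  rw [Finset.sum_const, Finset.card_univ, Finset.card_univ, ZMod.card, ZMod.card, smul_eq_mul] at h2
  simp only [hf]
  exact (Nat.eq_of_mul_eq_mul_left (NeZero.pos l) ((pow_two l).symm.trans h2)).symm

theorem Blem3 {α : Type*} (B : Finset α) (p q r : ℕ) (hp : p.Prime) (hq : q.Prime) (hr : r.Prime)
    (hpq : p < q) (hqr : q < r) [NeZero p] [NeZero q] [NeZero r]
    (T : α → ZMod (p^2)) (Y : α → ZMod q) (Z : α → ZMod r)
    (Z2 : α → ZMod (r^2)) (hZ2 : ∀ a, ((Z2 a).val : ZMod r) = Z a)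
    (hcard : B.card = p * q * r)
    (l1 : ∀ t t' : ZMod (p^2), (t.val : ZMod p) = t'.val → S1 B T t = S1 B T t')
    (l1r : ∀ t t' : ZMod (r^2), (t.val : ZMod r) = t'.val → S1 B Z2 t = S1 B Z2 t')
    (hB1 : ∀ b ∈ B, ∀ b' ∈ B, ((T b).val : ZMod p) = (T b').val ∨ Y b = Y b' ∨ Z b = Z b')
    (hB2 : ∀ b ∈ B, ∀ b' ∈ B, T b = T b' → Y b = Y b' ∨ Z b = Z b')
    (b b' c : α) (hb : b ∈ B) (hb' : b' ∈ B) (hc : c ∈ B)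
    (hX : ((T b).val : ZMod p) = (T b').val) (hXc : ((T c).val : ZMod p) ≠ (T b).val)
    (hY : Y b ≠ Y b') (hZ : Z b ≠ Z b') (hcY : Y c = Y b) (hcZ : Z c = Z b') :
    (∀ y, y ≠ Y b → ∀ z, cnt B T Y Z (T b) y z = 0) ∧
    (∀ z, z ≠ Z b' → ∀ y, cnt B T Y Z (T b') y z = 0) ∧
    ¬ (∀ t t' : ZMod (p^2), (t.val : ZMod p) = t'.val → ∀ y z y' z',
      (cnt B T Y Z t y z - cnt B T Y Z t' y z) - (cnt B T Y Z t y' z - cnt B T Y Z t' y' z)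
      - (cnt B T Y Z t y z' - cnt B T Y Z t' y z') + (cnt B T Y Z t y' z' - cnt B T Y Z t' y' z') = 0) := by
  have cross : ∀ b1 ∈ B, ((T b1).val : ZMod p) = (T b).val → Y b1 = Y c ∨ Z b1 = Z c := by
    intro b1 h1 h2
    rcases hB1 b1 h1 c hc with h | h | h
    · exact absurd (h.symm.trans h2) hXc
    · exact Or.inl h
    · exact Or.inr h
  have slice : ∀ t : ZMod (p^2), (t.val : ZMod p) = (T b).val →
      (∀ b1 ∈ B, T b1 = t → Y b1 = Y c) ∨ (∀ b1 ∈ B, T b1 = t → Z b1 = Z c) := by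
    intro t ht
    by_contra hcon
    push Not at hcon
    obtain ⟨⟨b1, h1, h2, h3⟩, ⟨b2, h4, h5, h6⟩⟩ := hcon
    have c1 := cross b1 h1 (by rw [h2]; exact ht)
    have c2 := cross b2 h4 (by rw [h5]; exact ht)
    rcases hB2 b1 h1 b2 h4 (h2.trans h5.symm) with h | h
    · rcases c2 with c2 | c2
      · exact h3 (h.trans c2)
      · exact h6 c2
    · rcases c1 with c1 | c1
      · exact h3 c1
      · exact h6 (h.symm.trans c1)
  have rowT : ∀ b1 ∈ B, T b1 = T b → Y b1 = Y c := by
    rcases slice (T b) rfl with h | h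
    · exact h
    · exact absurd ((h b hb rfl).trans hcZ) hZ
  have colT : ∀ b1 ∈ B, T b1 = T b' → Z b1 = Z c := by
    rcases slice (T b') hX.symm with h | h
    · exact absurd ((h b' hb' rfl).trans hcY).symm hY
    · exact h
  have rowz : ∀ t, (∀ b1 ∈ B, T b1 = t → Y b1 = Y c) → ∀ y z, y ≠ Y c → cnt B T Y Z t y z = 0 := by
    intro t ht y z hy
    by_contra hcon
    obtain ⟨a, ha, h1, h2, h3⟩ := cnt_ne _ _ _ _ _ _ _ hcon
    exact hy (h2.symm.trans (ht a ha h1))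
  have colz : ∀ t, (∀ b1 ∈ B, T b1 = t → Z b1 = Z c) → ∀ y z, z ≠ Z c → cnt B T Y Z t y z = 0 := by
    intro t ht y z hy
    by_contra hcon
    obtain ⟨a, ha, h1, h2, h3⟩ := cnt_ne _ _ _ _ _ _ _ hcon
    exact hy (h3.symm.trans (ht a ha h1))
  refine ⟨fun y hy z => rowz _ rowT y z (hcY ▸ hy), fun z hz y => colz _ colT y z (hcZ ▸ hz), ?_⟩
  intro l3
  have hyne : Y b' ≠ Y c := by rw [hcY]; exact hY.symm
  have hzne : Z b ≠ Z c := by rw [hcZ]; exact hZ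
  have cor : ∀ t : ZMod (p^2), (t.val : ZMod p) = (T b).val → (∀ b1 ∈ B, T b1 = t → Y b1 = Y c) → _ :=
    fun t ht hrow => core (cnt B T Y Z t) (cnt B T Y Z (T b')) (Y c) (Z c) (Y b') (Z b) hyne hzne
      (rowz t hrow) (colz _ colT) (by rw [cnt_sum, cnt_sum]; exact l1 _ _ (ht.trans hX))
      (l3 _ _ (ht.trans hX))
  simp only [ZMod.card] at cor
  obtain ⟨e1, e2, e3, e4⟩ := cor (T b) rfl rowT
  set v := cnt B T Y Z (T b) (Y c) (Z b) with hv
  set v' := cnt B T Y Z (T b') (Y b') (Z c) with hv'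
  have hvpos : 0 < v := by rw [hv, hcY]; exact cnt_pos B T Y Z b hb
  have hv'pos : 0 < v' := by rw [hv', hcZ]; exact cnt_pos B T Y Z b' hb'
  have hp2 := hp.two_le
  -- elements outside the p-class of b
  have outside : ∀ a ∈ B, ((T a).val : ZMod p) ≠ (T b).val → Z a ≠ Z b := by
    intro a ha hXa hZa
    have hYa : Y a = Y b' := by
      rcases hB1 a ha b' hb' with h | h | h
      · exact absurd (h.trans hX.symm) hXa
      · exact h
      · exact absurd (hZa.symm.trans h) hZ
    -- pick a third residue mod r
    obtain ⟨z2, hz2⟩ : ∃ z2 : ZMod r, z2 ∉ ({Z c, Z b} : Finset (ZMod r)) := by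
      by_contra hcon
      push Not at hcon
      have := Finset.card_le_card (fun z _ => hcon z : (univ : Finset (ZMod r)) ⊆ _)
      rw [Finset.card_univ, ZMod.card] at this
      have := this.trans Finset.card_le_two
      omega
    simp only [Finset.mem_insert, Finset.mem_singleton, not_or] at hz2
    have := e2 z2 hz2.1
    obtain ⟨a2, ha2, h1, h2, h3⟩ := cnt_ne B T Y Z (T b) (Y c) z2 (by rw [this]; exact hvpos.ne')
    rcases hB1 a ha a2 ha2 with h | h | h
    · rw [h1] at h; exact hXa h
    · rw [h2, hYa] at h; exact hyne h
    · rw [h3, hZa] at h; exact hz2.2 h.symm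
  -- count the class of Z b
  have cntZ : S1 B Z (Z b) = v * ((univ.filter (fun t : ZMod (p^2) => (t.val : ZMod p) = (T b).val)).filter
      (fun t => ∀ b1 ∈ B, T b1 = t → Y b1 = Y c)).card := by
    rw [← cnt_sumZ B T Y Z, Finset.filter_filter]
    rw [Finset.card_filter, Nat.cast_sum, Finset.mul_sum]
    apply Finset.sum_congr rfl
    intro t _
    by_cases ht : (t.val : ZMod p) = (T b).val
    · by_cases hrow : ∀ b1 ∈ B, T b1 = t → Y b1 = Y c
      · rw [if_pos ⟨ht, hrow⟩]
        rw [Finset.sum_eq_single (Y c) (fun y _ hy => rowz t hrow y _ hy) (by simp)]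
        obtain ⟨f1, _⟩ := cor t ht hrow
        have hr0 : (r : ℤ) ≠ 0 := by exact_mod_cast hr.ne_zero
        have : (r : ℤ) * cnt B T Y Z t (Y c) (Z b) = r * v := by rw [f1, e1]
        simpa using mul_left_cancel₀ hr0 this
      · rw [if_neg (fun h => hrow h.2)]
        have hcol := (slice t ht).resolve_left hrow
        simp [fun y => colz t hcol y _ hzne]
    · rw [if_neg (fun h => ht h.1)]
      simp only [Nat.cast_zero, mul_zero]
      apply Finset.sum_eq_zero
      intro y _
      by_contra hcon
      obtain ⟨a, ha, h1, h2, h3⟩ := cnt_ne _ _ _ _ _ _ _ hcon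
      exact outside a ha (by rw [h1]; exact ht) h3
  set τ := ((univ.filter (fun t : ZMod (p^2) => (t.val : ZMod p) = (T b).val)).filter
      (fun t => ∀ b1 ∈ B, T b1 = t → Y b1 = Y c)).card with hτ
  have hτpos : 0 < τ := Finset.card_pos.2 ⟨T b, by simp only [mem_filter, mem_univ, true_and]; exact rowT⟩
  have hτle : τ ≤ p := (Finset.card_filter_le _ _).trans (fiber_card p _).le
  have hdiv : (r : ℤ) ∣ S1 B Z (Z b) := by
    have h1 := S1_fiber B Z2 (fun s => (s.val : ZMod r)) (Z b)
    simp only [hZ2] at h1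
    rw [show S1 B Z (Z b) = S1 B (fun a => Z a) (Z b) from rfl, ← h1]
    rw [Finset.sum_congr rfl (fun s hs => l1r s (Z2 b) (by
      rw [hZ2]; exact (Finset.mem_filter.1 hs).2)), Finset.sum_const, fiber_card, nsmul_eq_mul]
    exact dvd_mul_right _ _
  rw [cntZ] at hdiv
  have hrp : Prime (r : ℤ) := Nat.prime_iff_prime_int.1 hr
  have hrv : (r : ℤ) ∣ v := by
    rcases hrp.dvd_or_dvd hdiv with h | h
    · exact h
    · have := Nat.le_of_dvd hτpos (by exact_mod_cast h)
      omega
  have hqv : (q : ℤ) ∣ v := by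
    have hqp : Prime (q : ℤ) := Nat.prime_iff_prime_int.1 hq
    rcases hqp.dvd_or_dvd (Dvd.intro _ e1.symm) with h | h
    · have := (Nat.prime_dvd_prime_iff_eq hq hr).1 (by exact_mod_cast h)
      omega
    · exact h
  have hqrv : (q * r : ℤ) ∣ v := by
    apply IsCoprime.mul_dvd _ hqv hrv
    exact Nat.isCoprime_iff_coprime.2 ((Nat.coprime_primes hq hr).2 (by omega))
  have hle := Int.le_of_dvd hvpos hqrv
  -- total
  have hk : (p : ℤ) * S1 B T (T b) ≤ p * q * r := by
    have h1 := S1_total B T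
    have h2 : ∑ t with (t.val : ZMod p) = (T b).val, S1 B T t ≤ ∑ t, S1 B T t :=
      Finset.sum_le_sum_of_subset_of_nonneg (Finset.subset_univ _) (fun t _ _ => S1_nonneg _ _ _)
    rw [Finset.sum_congr rfl (fun s hs => l1 s (T b) (Finset.mem_filter.1 hs).2), Finset.sum_const, fiber_card, nsmul_eq_mul, h1, hcard] at h2
    exact_mod_cast h2
  rw [cnt_sum] at e4
  have h0 := cnt_nonneg B T Y Z (T b) (Y c) (Z c)
  have hk2 : S1 B T (T b) ≤ q * r := by
    have hp0 : (0:ℤ) < p := by exact_mod_cast hp.pos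
    rw [mul_assoc] at hk
    exact le_of_mul_le_mul_left hk hp0
  have hr3 : (2:ℤ) < r := by exact_mod_cast (by omega : 2 < r)
  nlinarith

theorem lv1 {M : ℕ} (E : Finset (ZMod M)) (n l e : ℕ) [NeZero n] (hn : n = l ^ (e+1)) (hl : l.Prime)
    (H : Van E n) (t t' : ZMod n) (h : t.val ≡ t'.val [MOD l ^ e]) :
    S1 E (fun a => (a.val : ZMod n)) t = S1 E (fun a => (a.val : ZMod n)) t' := by
  have := van1 E n l e hn hl H t t' h
  simp only [dl, Finset.sum_sub_distrib] at this
  rw [sub_eq_zero] at this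
  simp only [S1]
  exact_mod_cast this

theorem lv2 {M : ℕ} (E : Finset (ZMod M)) (n l e n2 l2 e2 : ℕ) [NeZero n] [NeZero n2]
    (hn : n = l ^ (e+1)) (hl : l.Prime) (hn2 : n2 = l2 ^ (e2+1)) (hl2 : l2.Prime)
    (hc : n.Coprime n2)
    (H : Van E (n * n2)) (t t' : ZMod n) (h : t.val ≡ t'.val [MOD l ^ e])
    (y y' : ZMod n2) (h2 : y.val ≡ y'.val [MOD l2 ^ e2]) (f : ZMod n → ZMod n2 → ℤ)
    (hf : ∀ t y, f t y = ∑ a ∈ E, (if (a.val : ZMod n) = t then 1 else 0) * (if (a.val : ZMod n2) = y then 1 else 0)) :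
    f t y - f t' y = f t y' - f t' y' := by
  have := van2 E n l e n2 l2 e2 hn hl hn2 hl2 hc H t t' h y y' h2
  rw [← sub_eq_zero]
  have h3 : ((f t y - f t' y - (f t y' - f t' y') : ℤ) : ℂ) = 0 := by
    rw [← this]
    simp only [hf]
    push_cast
    simp only [← Finset.sum_sub_distrib]
    apply Finset.sum_congr rfl
    intro a _
    simp only [dl]
    ring
  exact_mod_cast h3

theorem lv3 {M : ℕ} (E : Finset (ZMod M)) (n l e n2 l2 e2 n3 l3 e3 : ℕ)
    [NeZero n] [NeZero n2] [NeZero n3]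
    (hn : n = l ^ (e+1)) (hl : l.Prime) (hn2 : n2 = l2 ^ (e2+1)) (hl2 : l2.Prime)
    (hn3 : n3 = l3 ^ (e3+1)) (hl3 : l3.Prime)
    (hc : n.Coprime n2) (hc' : (n * n2).Coprime n3)
    (H : Van E (n * n2 * n3)) (t t' : ZMod n) (h : t.val ≡ t'.val [MOD l ^ e])
    (y y' : ZMod n2) (h2 : y.val ≡ y'.val [MOD l2 ^ e2])
    (z z' : ZMod n3) (h3 : z.val ≡ z'.val [MOD l3 ^ e3]) (f : ZMod n → ZMod n2 → ZMod n3 → ℤ)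
    (hf : ∀ t y z, f t y z = cnt E (fun a => (a.val : ZMod n)) (fun a => (a.val : ZMod n2)) (fun a => (a.val : ZMod n3)) t y z) :
    (f t y z - f t' y z) - (f t y' z - f t' y' z)
      - (f t y z' - f t' y z') + (f t y' z' - f t' y' z') = 0 := by
  have := van3 E n l e n2 l2 e2 n3 l3 e3 hn hl hn2 hl2 hn3 hl3 hc hc' H t t' h y y' h2 z z' h3
  have h3 : (((f t y z - f t' y z) - (f t y' z - f t' y' z)
      - (f t y z' - f t' y z') + (f t y' z' - f t' y' z') : ℤ) : ℂ) = 0 := by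
    rw [← this]
    simp only [hf, cnt]
    push_cast
    simp only [← Finset.sum_sub_distrib, ← Finset.sum_add_distrib]
    apply Finset.sum_congr rfl
    intro a _
    simp only [dl]
    ring
  exact_mod_cast h3

theorem equi {M : ℕ} (E : Finset (ZMod M)) (l : ℕ) [NeZero l] (hl : l.Prime) (H : Van E l) (x : ZMod l) :
    l * S1 E (fun a => (a.val : ZMod l)) x = E.card := by
  rw [← S1_total E (fun a => (a.val : ZMod l))]
  rw [Finset.sum_congr rfl (fun x' _ => lv1 E l l 0 (by simp) hl H x' x (by simp [Nat.modEq_one]))]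
  simp [ZMod.card]

theorem resres (l x : ℕ) [NeZero l] : (((x : ZMod (l^2)).val : ℕ) : ZMod l) = (x : ZMod l) := by
  rw [ZMod.val_natCast, ZMod.natCast_eq_natCast_iff]
  exact (Nat.mod_modEq x (l^2)).of_dvd (Dvd.intro_left (l ^ 1) (by ring))

theorem S1_slices {M : ℕ} (E : Finset (ZMod M)) (l : ℕ) [NeZero l] (x : ZMod l) :
    ∑ t : ZMod (l^2) with (t.val : ZMod l) = x, S1 E (fun a => (a.val : ZMod (l^2))) t
      = S1 E (fun a => (a.val : ZMod l)) x := by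
  have := S1_fiber E (fun a => (a.val : ZMod (l^2))) (fun t => (t.val : ZMod l)) x
  simp only [resres] at this
  exact this

theorem not_both {M : ℕ} (E : Finset (ZMod M)) (l k : ℕ) [NeZero l] (hl : l.Prime) (hc : E.card = l * k)
    (hk : ¬ l ∣ k) (H : Van E l) : ¬ Van E (l ^ 2) := by
  intro H2
  have h1 := equi E l hl H 0
  rw [← S1_slices E l 0, Finset.sum_congr rfl (fun t ht => lv1 E (l^2) l 1 rfl hl H2 t 0 (by
    have := (Finset.mem_filter.1 ht).2
    rw [pow_one, ← ZMod.natCast_eq_natCast_iff, this]; simp)), Finset.sum_const, fiber_card, nsmul_eq_mul, hc] at h1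
  push_cast at h1
  have hl0 : (l : ℤ) ≠ 0 := by exact_mod_cast hl.ne_zero
  have := mul_left_cancel₀ hl0 h1
  exact hk (by exact_mod_cast (Dvd.intro _ this))

theorem dvd_sub_val {M m : ℕ} [NeZero M] (h : m ∣ M) (a b : ZMod M) :
    m ∣ (a - b).val ↔ (a.val : ZMod m) = (b.val : ZMod m) := by
  rw [← ZMod.natCast_eq_zero_iff]
  simp only [ZMod.natCast_val]
  rw [← ZMod.castHom_apply (h := h), ← ZMod.castHom_apply (h := h), ← ZMod.castHom_apply (h := h), map_sub, sub_eq_zero]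

theorem gcd_cases (p q r D : ℕ) (hp : p.Prime) (hq : q.Prime) (hr : r.Prime)
    (h1 : ¬ q ∣ D) (h2 : ¬ r ∣ D) :
    (¬ p ∣ D → Nat.gcd D (p^2 * q^2 * r^2) = 1) ∧
    (p ∣ D → ¬ p^2 ∣ D → Nat.gcd D (p^2 * q^2 * r^2) = p) ∧
    (p^2 ∣ D → Nat.gcd D (p^2 * q^2 * r^2) = p^2) := by
  have e : Nat.gcd D (p^2 * q^2 * r^2) = Nat.gcd D (p^2) := by
    rw [Nat.Coprime.gcd_mul_right_cancel_right, Nat.Coprime.gcd_mul_right_cancel_right]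
    · exact Nat.Coprime.pow_left 2 ((Nat.Prime.coprime_iff_not_dvd hq).2 h1)
    · exact Nat.Coprime.pow_left 2 ((Nat.Prime.coprime_iff_not_dvd hr).2 h2)
  rw [e]
  refine ⟨fun h => ?_, fun h h' => ?_, fun h => Nat.gcd_eq_right h⟩
  · exact (Nat.Coprime.pow_left 2 ((Nat.Prime.coprime_iff_not_dvd hp).2 h)).symm
  · obtain ⟨i, hi, hio⟩ := (Nat.dvd_prime_pow hp).1 (Nat.gcd_dvd_right D (p^2))
    have hpd : p ∣ Nat.gcd D (p^2) := Nat.dvd_gcd h (dvd_pow_self p (by norm_num))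
    interval_cases i
    · rw [hio] at hpd; exact absurd (by simpa using hpd) hp.one_lt.ne'
    · simpa using hio
    · exact absurd (hio ▸ Nat.gcd_dvd_left D (p^2)) h'

theorem Alem {α : Type*} (A : Finset α) (p q r : ℕ) (hp : p.Prime) (hq : q.Prime) (hr : r.Prime)
    (hpq : p < q) (hqr : q < r) [NeZero p] [NeZero q] [NeZero r]
    (T : α → ZMod (p^2)) (Y : α → ZMod q) (Z : α → ZMod r)
    (hN : ∀ x : ZMod p, ∑ t with (t.val : ZMod p) = x, S1 A T t = q * r)
    (hD : ∀ t t' : ZMod (p^2), (t.val : ZMod p) = t'.val → ∀ y z y' z',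
      cnt A T Y Z t y z - cnt A T Y Z t' y z = cnt A T Y Z t y' z' - cnt A T Y Z t' y' z')
    (hA1 : ∀ a ∈ A, ∀ a' ∈ A, ((T a).val : ZMod p) = (T a').val → T a ≠ T a' → Y a = Y a' ∨ Z a = Z a')
    (a a' : α) (ha : a ∈ A) (ha' : a' ∈ A) (hne : a ≠ a') (hT : T a = T a') (hY : Y a = Y a')
    (hZ : Z a = Z a') : False := by
  have htwo : 2 ≤ cnt A T Y Z (T a) (Y a) (Z a) := by
    classical
    have h1 : ∑ x ∈ ({a, a'} : Finset α), ((if T x = T a then 1 else 0) * (if Y x = Y a then 1 else 0) * (if Z x = Z a then 1 else 0) : ℤ) ≤ cnt A T Y Z (T a) (Y a) (Z a) := by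
      apply Finset.sum_le_sum_of_subset_of_nonneg
      · intro x hx
        simp only [Finset.mem_insert, Finset.mem_singleton] at hx
        rcases hx with rfl | rfl <;> assumption
      · intro x _ _; split_ifs <;> simp
    rw [Finset.sum_pair hne] at h1
    simp only [hT, hY, hZ, if_true] at h1 ⊢
    linarith
  have hle : S1 A T (T a) ≤ q * r := by
    rw [← hN ((T a).val : ZMod p)]
    exact Finset.single_le_sum (f := fun t => S1 A T t) (fun t _ => S1_nonneg A T t) (by simp)
  have hzero : ∃ y z, cnt A T Y Z (T a) y z = 0 := by
    by_contra hcon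
    push Not at hcon
    have h1 : ∀ y z, 1 ≤ cnt A T Y Z (T a) y z := fun y z => by
      have := cnt_nonneg A T Y Z (T a) y z
      have := hcon y z
      omega
    have h2 : ∑ y : ZMod q, ∑ z : ZMod r, (1:ℤ) < ∑ y, ∑ z, cnt A T Y Z (T a) y z := by
      apply Finset.sum_lt_sum
      · intro y _; exact Finset.sum_le_sum (fun z _ => h1 y z)
      · refine ⟨Y a, Finset.mem_univ _, ?_⟩
        apply Finset.sum_lt_sum (fun z _ => h1 _ z)
        exact ⟨Z a, Finset.mem_univ _, by linarith⟩
    rw [cnt_sum] at h2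
    simp [ZMod.card] at h2
    linarith
  obtain ⟨y0, z0, h0⟩ := hzero
  have hall : ∀ t : ZMod (p^2), (t.val : ZMod p) = (T a).val → S1 A T t = S1 A T (T a) := by
    intro t ht
    by_cases hta : t = T a
    · rw [hta]
    have hzt : ∃ y z, cnt A T Y Z t y z = 0 := by
      by_contra hcon
      push Not at hcon
      haveI : Nontrivial (ZMod q) := ZMod.nontrivial_iff.2 hq.one_lt.ne'
      haveI : Nontrivial (ZMod r) := ZMod.nontrivial_iff.2 hr.one_lt.ne'
      obtain ⟨y1, hy1⟩ := exists_ne (Y a)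
      obtain ⟨z1, hz1⟩ := exists_ne (Z a)
      obtain ⟨a2, h1, h2, h3, h4⟩ := cnt_ne _ _ _ _ _ _ _ (hcon y1 z1)
      rcases hA1 a2 h1 a ha (by rw [h2]; exact ht) (by rw [h2]; exact hta) with h | h
      · exact hy1 (h3.symm.trans h)
      · exact hz1 (h4.symm.trans h)
    obtain ⟨y1, z1, h1⟩ := hzt
    have e := hD t (T a) ht
    have e1 := e y0 z0 y1 z1
    have p1 := cnt_nonneg A T Y Z t y0 z0
    have p2 := cnt_nonneg A T Y Z (T a) y1 z1
    have e2 : ∀ y z, cnt A T Y Z t y z = cnt A T Y Z (T a) y z := by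
      intro y z
      have := e y z y0 z0
      linarith
    rw [← cnt_sum A T Y Z t, ← cnt_sum A T Y Z (T a)]
    simp only [e2]
  have hfin := hN ((T a).val : ZMod p)
  rw [Finset.sum_congr rfl (fun t ht => hall t (Finset.mem_filter.1 ht).2), Finset.sum_const, fiber_card, nsmul_eq_mul] at hfin
  have hd : p ∣ q * r := by exact_mod_cast (Dvd.intro _ hfin)
  rcases (Nat.Prime.dvd_mul hp).1 hd with h | h
  · have := (Nat.prime_dvd_prime_iff_eq hp hq).1 h; omega
  · have := (Nat.prime_dvd_prime_iff_eq hp hr).1 h; omega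

set_option maxHeartbeats 1000000

/-- Proposition 2.9(iii): under the standing hypotheses,
`{p²qr, p²q²r, p²qr²} ∩ Div(A) = ∅`. -/
theorem stmt_18 (p q r M : ℕ) (hp : p.Prime) (hq : q.Prime) (hr : r.Prime)
    (hpq : p < q) (hqr : q < r) (hM : M = p ^ 2 * q ^ 2 * r ^ 2)
    (A B : Finset (ZMod M)) (hT : Tiles A B)
    (hA : A.card = p * q * r) (hB : B.card = p * q * r)
    (h0A : (0 : ZMod M) ∈ A) (h0B : (0 : ZMod M) ∈ B)
    (hApr : NotInProperSubgroup A) (hBpr : NotInProperSubgroup B)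
    (hone : 1 ∉ DivSet B)
    (hPhi : cyclotomic p ℤ * cyclotomic q ℤ * cyclotomic r ℤ ∣ maskPoly A)
    (hpB : p ∈ DivSet B) (hqB : q ∈ DivSet B)
    (hp2B : p ^ 2 ∉ DivSet B) (hq2B : q ^ 2 ∉ DivSet B) :
    ({p ^ 2 * q * r, p ^ 2 * q ^ 2 * r, p ^ 2 * q * r ^ 2} : Set ℕ)
      ∩ DivSet A = ∅ := by
  classical
  haveI : NeZero p := ⟨hp.ne_zero⟩
  haveI : NeZero q := ⟨hq.ne_zero⟩
  haveI : NeZero r := ⟨hr.ne_zero⟩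
  have hp0 := hp.pos
  have hq0 := hq.pos
  have hr0 := hr.pos
  haveI : NeZero M := ⟨by rw [hM]; positivity⟩
  have cpq : p.Coprime q := (Nat.coprime_primes hp hq).2 (by omega)
  have cpr : p.Coprime r := (Nat.coprime_primes hp hr).2 (by omega)
  have cqr : q.Coprime r := (Nat.coprime_primes hq hr).2 (by omega)
  have dP : p ^ 2 ∣ M := ⟨q^2 * r^2, by rw [hM]; ring⟩
  have dR : r ^ 2 ∣ M := ⟨p^2 * q^2, by rw [hM]; ring⟩
  have dp : p ∣ M := ⟨p * q^2 * r^2, by rw [hM]; ring⟩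
  have dq : q ∣ M := ⟨p^2 * q * r^2, by rw [hM]; ring⟩
  have dr : r ∣ M := ⟨p^2 * q^2 * r, by rw [hM]; ring⟩
  have dPq : p ^ 2 * q ∣ M := ⟨q * r^2, by rw [hM]; ring⟩
  have dPr : p ^ 2 * r ∣ M := ⟨q^2 * r, by rw [hM]; ring⟩
  have dPqr : p ^ 2 * q * r ∣ M := ⟨q * r, by rw [hM]; ring⟩
  have p2 := hp.two_le
  have q2 := hq.two_le
  have r2 := hr.two_le
  have pp1 : 1 < p ^ 2 := Nat.one_lt_pow (by norm_num) hp.one_lt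
  -- differences
  have key : ∀ a b : ZMod M, (a.val : ZMod q) ≠ b.val → (a.val : ZMod r) ≠ b.val →
      ((a.val : ZMod p) ≠ b.val → Nat.gcd (a - b).val M = 1) ∧
      ((a.val : ZMod p) = b.val → (a.val : ZMod (p^2)) ≠ b.val → Nat.gcd (a - b).val M = p) ∧
      ((a.val : ZMod (p^2)) = b.val → Nat.gcd (a - b).val M = p^2) := by
    intro a b h1 h2
    have := gcd_cases p q r (a - b).val hp hq hr (by rwa [dvd_sub_val dq]) (by rwa [dvd_sub_val dr])
    rw [← hM, dvd_sub_val dp, dvd_sub_val dP] at this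
    exact this
  have hB1 : ∀ b ∈ B, ∀ b' ∈ B, (b.val : ZMod p) = b'.val ∨ (b.val : ZMod q) = b'.val ∨ (b.val : ZMod r) = b'.val := by
    intro b hb b' hb'
    by_contra hcon
    push Not at hcon
    exact hone ⟨b, hb, b', hb', (key b b' hcon.2.1 hcon.2.2).1 hcon.1⟩
  have hB2 : ∀ b ∈ B, ∀ b' ∈ B, (b.val : ZMod (p^2)) = b'.val → (b.val : ZMod q) = b'.val ∨ (b.val : ZMod r) = b'.val := by
    intro b hb b' hb' h
    by_contra hcon
    push Not at hcon
    exact hp2B ⟨b, hb, b', hb', (key b b' hcon.1 hcon.2).2.2 h⟩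
  have hpA : p ∉ DivSet A := by
    intro h
    have := sands hT p h hpB
    have h3 := Nat.le_of_dvd (NeZero.pos M) dP
    rw [← this] at h3
    nlinarith
  have hA1 : ∀ a ∈ A, ∀ a' ∈ A, (a.val : ZMod p) = a'.val → (a.val : ZMod (p^2)) ≠ a'.val →
      (a.val : ZMod q) = a'.val ∨ (a.val : ZMod r) = a'.val := by
    intro b hb b' hb' h h'
    by_contra hcon
    push Not at hcon
    exact hpA ⟨b, hb, b', hb', (key b b' hcon.1 hcon.2).2.1 h h'⟩
  obtain ⟨b, hb, b', hb', c, hc, hX, hXc, hY, hZ, hcY, hcZ⟩ : ∃ b ∈ B, ∃ b' ∈ B, ∃ c ∈ B,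
      (b.val : ZMod p) = b'.val ∧ (c.val : ZMod p) ≠ b.val ∧ (b.val : ZMod q) ≠ b'.val ∧
      (b.val : ZMod r) ≠ b'.val ∧ (c.val : ZMod q) = b.val ∧ (c.val : ZMod r) = b'.val := by
    obtain ⟨b, hb, b', hb', hg⟩ := hpB
    have hX : (b.val : ZMod p) = b'.val := by
      rw [← dvd_sub_val dp]; nth_rewrite 1 [← hg]; exact Nat.gcd_dvd_left _ _
    have hY : (b.val : ZMod q) ≠ b'.val := by
      rw [Ne, ← dvd_sub_val dq]
      intro h
      have := Nat.dvd_gcd h dq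
      rw [hg] at this
      have := (Nat.prime_dvd_prime_iff_eq hq hp).1 this
      omega
    have hZ : (b.val : ZMod r) ≠ b'.val := by
      rw [Ne, ← dvd_sub_val dr]
      intro h
      have := Nat.dvd_gcd h dr
      rw [hg] at this
      have := (Nat.prime_dvd_prime_iff_eq hr hp).1 this
      omega
    obtain ⟨c, hc, hXc⟩ : ∃ c ∈ B, (c.val : ZMod p) ≠ b.val := by
      by_contra hcon
      push Not at hcon
      obtain ⟨x, hx, hx'⟩ := hBpr p dp hp.one_lt
      apply hx'
      rw [← ZMod.natCast_eq_zero_iff, hcon x hx, ← hcon 0 h0B]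
      simp
    rcases hB1 c hc b hb with h | h | h
    · exact absurd h hXc
    · rcases hB1 c hc b' hb' with h' | h' | h'
      · exact absurd (h'.trans hX.symm) hXc
      · exact absurd (h.symm.trans h') hY
      · exact ⟨b, hb, b', hb', c, hc, hX, hXc, hY, hZ, h, h'⟩
    · rcases hB1 c hc b' hb' with h' | h' | h'
      · exact absurd (h'.trans hX.symm) hXc
      · exact ⟨b', hb', b, hb, c, hc, hX.symm, fun e => hXc (e.trans hX.symm), hY.symm, hZ.symm, h', h⟩
      · exact absurd (h.symm.trans h') hZ
  have vAp : Van A p := van_of_dvd A p hp0 ((Dvd.intro _ rfl : cyclotomic p ℤ ∣ _).trans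
    ((Dvd.intro _ rfl : cyclotomic p ℤ * cyclotomic q ℤ ∣ _).trans hPhi))
  have vAr : Van A r := van_of_dvd A r hr0 ((Dvd.intro_left _ rfl : cyclotomic r ℤ ∣ _).trans hPhi)
  have npd : ¬ p ∣ q * r := (Nat.Prime.coprime_iff_not_dvd hp).1 (Nat.Coprime.mul_right cpq cpr)
  have nrd : ¬ r ∣ p * q := (Nat.Prime.coprime_iff_not_dvd hr).1 (Nat.Coprime.mul_right cpr.symm cqr.symm)
  have vd : ∀ s, s ∣ M → 1 < s → Van A s ∨ Van B s := fun s hs h1 => by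
    rcases dich hT s hs h1 with h | h
    · exact Or.inl (van_of_dvd A s (by omega) h)
    · exact Or.inr (van_of_dvd B s (by omega) h)
  have vBP : Van B (p^2) := (vd _ dP pp1).resolve_left
    (not_both A p (q * r) hp (by rw [hA]; ring) npd vAp)
  have vBR : Van B (r^2) := (vd _ dR (Nat.one_lt_pow (by norm_num) hr.one_lt)).resolve_left
    (not_both A r (p * q) hr (by rw [hA]; ring) nrd vAr)
  have cPq : (p^2).Coprime q := Nat.Coprime.pow_left 2 cpq
  have cPr : (p^2).Coprime r := Nat.Coprime.pow_left 2 cpr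
  have cPqr : (p^2 * q).Coprime r := Nat.Coprime.mul_left cPr cqr
  have me : ∀ l : ℕ, ∀ t t' : ZMod (l^2), (t.val : ZMod l) = t'.val → t.val ≡ t'.val [MOD l ^ 1] := by
    intro l t t' h
    rw [pow_one]; exact (ZMod.natCast_eq_natCast_iff _ _ _).1 h
  have m0 : ∀ l x y : ℕ, x ≡ y [MOD l ^ 0] := fun l x y => by rw [pow_zero]; exact Nat.modEq_one
  set T : ZMod M → ZMod (p^2) := fun a => (a.val : ZMod (p^2)) with hTd
  set Y : ZMod M → ZMod q := fun a => (a.val : ZMod q) with hYd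
  set Z : ZMod M → ZMod r := fun a => (a.val : ZMod r) with hZd
  have hTX : ∀ a, ((T a).val : ZMod p) = (a.val : ZMod p) := fun a => resres p a.val
  have l1 : ∀ t t' : ZMod (p^2), (t.val : ZMod p) = t'.val → S1 B T t = S1 B T t' :=
    fun t t' h => lv1 B (p^2) p 1 rfl hp vBP t t' (me p t t' h)
  obtain ⟨rowB, colB, nlev3⟩ := Blem3 B p q r hp hq hr hpq hqr T Y Z (fun a => (a.val : ZMod (r^2)))
    (fun a => resres r a.val) hB l1
    (fun t t' h => lv1 B (r^2) r 1 rfl hr vBR t t' (me r t t' h))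
    (by simpa only [hTX] using hB1) hB2 b b' c hb hb' hc (by rw [hTX, hTX]; exact hX)
    (by rw [hTX, hTX]; exact hXc) hY hZ hcY hcZ
  have hTbb : ((T b).val : ZMod p) = (T b').val := by rw [hTX, hTX]; exact hX
  have s12 : S1 B T (T b) = S1 B T (T b') := l1 _ _ hTbb
  have vA3 : Van A (p^2 * q * r) := by
    refine (vd _ dPqr (one_lt_mul'' (one_lt_mul'' pp1 hq.one_lt) hr.one_lt)).resolve_right (fun h => nlev3 ?_)
    intro t t' ht y z y' z'
    exact lv3 B (p^2) p 1 q q 0 r r 0 rfl hp (by simp) hq (by simp) hr cPq cPqr h t t' (me p t t' ht)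
      y y' (m0 _ _ _) z z' (m0 _ _ _) (cnt B T Y Z) (fun _ _ _ => rfl)
  have vA2 : Van A (p^2 * q) := by
    refine (vd _ dPq (one_lt_mul'' pp1 hq.one_lt)).resolve_right (fun h => ?_)
    have e := fun y y' => lv2 B (p^2) p 1 q q 0 rfl hp (by simp) hq cPq h (T b) (T b') (me p _ _ hTbb)
      y y' (m0 _ _ _) (fun t y => ∑ z, cnt B T Y Z t y z) (fun t y => cnt_sum_z B T Y Z t y)
    have e0 : ∑ y, (∑ z, cnt B T Y Z (T b) y z - ∑ z, cnt B T Y Z (T b') y z) = 0 := by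
      rw [Finset.sum_sub_distrib, cnt_sum, cnt_sum, s12, sub_self]
    rw [Finset.sum_congr rfl (fun y _ => e y (Y b')), Finset.sum_const, Finset.card_univ, ZMod.card, nsmul_eq_mul] at e0
    have e1 := (mul_eq_zero.1 e0).resolve_left (by exact_mod_cast hq.ne_zero)
    rw [Finset.sum_eq_zero (fun z _ => rowB (Y b') hY.symm z)] at e1
    have e2 : cnt B T Y Z (T b') (Y b') (Z b') ≤ ∑ z, cnt B T Y Z (T b') (Y b') z :=
      Finset.single_le_sum (f := fun z => cnt B T Y Z (T b') (Y b') z) (fun z _ => cnt_nonneg _ _ _ _ _ _ _) (Finset.mem_univ _)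
    have e3 := cnt_pos B T Y Z b' hb'
    linarith
  have vA2' : Van A (p^2 * r) := by
    refine (vd _ dPr (one_lt_mul'' pp1 hr.one_lt)).resolve_right (fun h => ?_)
    have e := fun y y' => lv2 B (p^2) p 1 r r 0 rfl hp (by simp) hr cPr h (T b) (T b') (me p _ _ hTbb)
      y y' (m0 _ _ _) (fun t z => ∑ y, cnt B T Y Z t y z) (fun t z => cnt_sum_y B T Y Z t z)
    have e0 : ∑ z, (∑ y, cnt B T Y Z (T b) y z - ∑ y, cnt B T Y Z (T b') y z) = 0 := by
      rw [Finset.sum_sub_distrib, Finset.sum_comm, cnt_sum, Finset.sum_comm, cnt_sum, s12, sub_self]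
    rw [Finset.sum_congr rfl (fun y _ => e y (Z b)), Finset.sum_const, Finset.card_univ, ZMod.card, nsmul_eq_mul] at e0
    have e1 := (mul_eq_zero.1 e0).resolve_left (by exact_mod_cast hr.ne_zero)
    rw [Finset.sum_eq_zero (fun y _ => colB (Z b) hZ y)] at e1
    have e2 : cnt B T Y Z (T b) (Y b) (Z b) ≤ ∑ y, cnt B T Y Z (T b) y (Z b) :=
      Finset.single_le_sum (f := fun y => cnt B T Y Z (T b) y (Z b)) (fun z _ => cnt_nonneg _ _ _ _ _ _ _) (Finset.mem_univ _)
    have e3 := cnt_pos B T Y Z b hb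
    linarith
  -- conclusion
  rw [Set.eq_empty_iff_forall_notMem]
  rintro d ⟨hd, a, ha, a', ha', hg⟩
  have hdd : p^2 * q * r ∣ d ∧ d ≠ M := by
    have hpos : 0 < p^2 * q * r := by positivity
    have l3 : p^2 * q * r < p^2 * q * r * (q * r) :=
      lt_mul_of_one_lt_right hpos (one_lt_mul'' hq.one_lt hr.one_lt)
    have l4 : p^2 * q * r * q < p^2 * q * r * (q * r) :=
      Nat.mul_lt_mul_of_pos_left (lt_mul_of_one_lt_right hq0 hr.one_lt) hpos
    have l5 : p^2 * q * r * r < p^2 * q * r * (q * r) :=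
      Nat.mul_lt_mul_of_pos_left (lt_mul_of_one_lt_left hr0 hq.one_lt) hpos
    have eM : M = p^2 * q * r * (q * r) := by rw [hM]; ring
    simp only [Set.mem_insert_iff, Set.mem_singleton_iff] at hd
    rcases hd with rfl | rfl | rfl
    · exact ⟨dvd_rfl, by rw [eM]; exact l3.ne⟩
    · exact ⟨⟨q, by ring⟩, by rw [eM, show p^2*q^2*r = p^2*q*r*q by ring]; exact l4.ne⟩
    · exact ⟨⟨r, by ring⟩, by rw [eM, show p^2*q*r^2 = p^2*q*r*r by ring]; exact l5.ne⟩
  obtain ⟨hdd, hdM⟩ := hdd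
  have hdv : p^2 * q * r ∣ (a - a').val := hdd.trans (hg ▸ Nat.gcd_dvd_left _ _)
  have hne : a ≠ a' := by
    rintro rfl
    apply hdM; rw [← hg]; simp
  refine Alem A p q r hp hq hr hpq hqr T Y Z ?_ ?_ ?_ a a' ha ha' hne
    ((dvd_sub_val dP a a').1 ((Dvd.intro (q * r) (by ring)).trans hdv))
    ((dvd_sub_val dq a a').1 ((Dvd.intro (p^2 * r) (by ring)).trans hdv))
    ((dvd_sub_val dr a a').1 ((Dvd.intro (p^2 * q) (by ring)).trans hdv))
  · intro x
    have h1 := S1_slices A p x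
    have h2 := equi A p hp vAp x
    rw [← h1, hA] at h2
    have hpz : (p : ℤ) ≠ 0 := by exact_mod_cast hp.ne_zero
    apply mul_left_cancel₀ hpz
    rw [h2]; push_cast; ring
  · intro t t' ht y z y' z'
    refine const_of (fun y z => cnt A T Y Z t y z - cnt A T Y Z t' y z) ?_ ?_ ?_ y z y' z'
    · intro y z y' z'
      exact lv3 A (p^2) p 1 q q 0 r r 0 rfl hp (by simp) hq (by simp) hr cPq cPqr vA3 t t' (me p t t' ht)
        y y' (m0 _ _ _) z z' (m0 _ _ _) (cnt A T Y Z) (fun _ _ _ => rfl)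
    · intro y y'
      rw [Finset.sum_sub_distrib, Finset.sum_sub_distrib]
      exact lv2 A (p^2) p 1 q q 0 rfl hp (by simp) hq cPq vA2 t t' (me p _ _ ht)
        y y' (m0 _ _ _) (fun t y => ∑ z, cnt A T Y Z t y z) (fun t y => cnt_sum_z A T Y Z t y)
    · intro z z'
      rw [Finset.sum_sub_distrib, Finset.sum_sub_distrib]
      exact lv2 A (p^2) p 1 r r 0 rfl hp (by simp) hr cPr vA2' t t' (me p _ _ ht)
        z z' (m0 _ _ _) (fun t z => ∑ y, cnt A T Y Z t y z) (fun t z => cnt_sum_y A T Y Z t z)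
  · simpa only [hTX] using hA1
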